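/- Let G be a finite d-regular simple graph with d ≥ 1 and let p be a real number with 0 ≤ p ≤ 1. Then t_e(G,p) ≤ (1 − p^d)^{i(G)}, where i(G) is the independence number of G. -/

import Mathlib

open Classical in
/-- The edge-fault (EF) tolerance `t_e(G, p)`: the probability that `G` remains
connected when each edge is deleted independently with probability `p`. -/
noncomputable def efTolerance {V : Type*} [Fintype V] (G : SimpleGraph V) (p : ℝ) : ℝ :=
  ∑ F ∈ G.edgeFinset.powerset,
    if (G.deleteEdges (↑F : Set (Sym2 V))).Connected then
      p ^ F.card * (1 - p) ^ (G.edgeFinset.card - F.card)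
    else 0

/-- The independence number `i(G)`: the maximum cardinality of a set of pairwise
non-adjacent vertices of `G`. -/
noncomputable def indepNum {V : Type*} [Fintype V] (G : SimpleGraph V) : ℕ :=
  sSup {n | ∃ W : Finset V, (∀ u ∈ W, ∀ v ∈ W, ¬ G.Adj u v) ∧ W.card = n}


open Classical in
theorem ef_aux {α β : Type*} (p : ℝ) (A : β → Finset α) (W : Finset β) :
    ∀ E : Finset α, (∀ w ∈ W, A w ⊆ E) →
      (∀ u ∈ W, ∀ v ∈ W, u ≠ v → Disjoint (A u) (A v)) →
      (∑ F ∈ E.powerset, if (∀ w ∈ W, ¬ A w ⊆ F) then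
        p ^ F.card * (1 - p) ^ (E.card - F.card) else 0) = ∏ w ∈ W, (1 - p ^ (A w).card) := by
  induction W using Finset.induction_on with
  | empty =>
    intro E _ _
    have := Finset.sum_pow_mul_eq_add_pow p (1 - p) E
    simpa using this
  | insert w W hw ih =>
    intro E hE hd
    have hAE : A w ⊆ E := hE w (by simp)
    have hdw : ∀ u ∈ W, Disjoint (A u) (A w) := fun u hu =>
      hd u (by simp [hu]) w (by simp) (by rintro rfl; exact hw hu)
    rw [Finset.prod_insert hw]
    rw [← ih (E \ A w) (fun u hu => Finset.subset_sdiff.2 ⟨hE u (by simp [hu]), hdw u hu⟩)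
      (fun u hu v hv => hd u (by simp [hu]) v (by simp [hv]))]
    have h1 : (1 - p ^ (A w).card) = ∑ F ∈ (A w).powerset, if ¬ A w ⊆ F then
        p ^ F.card * (1 - p) ^ ((A w).card - F.card) else 0 := by
      have h := Finset.sum_pow_mul_eq_add_pow p (1 - p) (A w)
      have h2 : ∑ F ∈ (A w).powerset, (if A w ⊆ F then
        p ^ F.card * (1 - p) ^ ((A w).card - F.card) else 0) = p ^ (A w).card := by
        rw [Finset.sum_eq_single (A w)]
        · simp
        · intro F hF hne
          rw [if_neg]
          intro h
          exact hne (Finset.Subset.antisymm (Finset.mem_powerset.1 hF) h)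
        · simp
      have h3 : ∀ F : Finset α, (if ¬ A w ⊆ F then
        p ^ F.card * (1 - p) ^ ((A w).card - F.card) else 0) =
        p ^ F.card * (1 - p) ^ ((A w).card - F.card) - (if A w ⊆ F then
        p ^ F.card * (1 - p) ^ ((A w).card - F.card) else 0) := by
        intro F; by_cases h : A w ⊆ F <;> simp [h]
      rw [Finset.sum_congr rfl (fun F _ => h3 F), Finset.sum_sub_distrib, h2, h]
      simp
    rw [h1, Finset.sum_mul_sum, ← Finset.sum_product']
    refine Finset.sum_bij' (fun F _ => (F ∩ A w, F \ A w)) (fun q _ => q.1 ∪ q.2) ?_ ?_ ?_ ?_ ?_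
    · intro F hF
      simp only [Finset.mem_powerset] at hF
      simp only [Finset.mem_product, Finset.mem_powerset]
      exact ⟨Finset.inter_subset_right, Finset.sdiff_subset_sdiff hF subset_rfl⟩
    · intro q hq
      simp only [Finset.mem_product, Finset.mem_powerset] at hq ⊢
      exact Finset.union_subset (hq.1.trans hAE) (hq.2.trans Finset.sdiff_subset)
    · intro F hF
      ext x; simp; tauto
    · intro q hq
      simp only [Finset.mem_product, Finset.mem_powerset] at hq
      have ha : ∀ x, x ∈ q.1 → x ∈ A w := fun x hx => hq.1 hx
      have hb : ∀ x, x ∈ q.2 → x ∉ A w := fun x hx => (Finset.mem_sdiff.1 (hq.2 hx)).2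
      ext x
      · simp; grind
      · simp; grind
    · intro F hF
      simp only [Finset.mem_powerset] at hF
      have e1 : A w ⊆ F ∩ A w ↔ A w ⊆ F := by simp [Finset.subset_inter_iff]
      have e2 : (∀ u ∈ W, ¬ A u ⊆ F \ A w) ↔ ∀ u ∈ W, ¬ A u ⊆ F := by
        refine forall₂_congr fun u hu => not_congr ?_
        rw [Finset.subset_sdiff]
        exact and_iff_left (hdw u hu)
      have c1 : (F ∩ A w).card + (F \ A w).card = F.card := Finset.card_inter_add_card_sdiff F (A w)
      have c2 : (E \ A w).card + (A w).card = E.card := Finset.card_sdiff_add_card_eq_card hAE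
      have c3 : (F ∩ A w).card ≤ (A w).card := Finset.card_le_card Finset.inter_subset_right
      have c4 : (F \ A w).card ≤ (E \ A w).card :=
        Finset.card_le_card (Finset.sdiff_subset_sdiff hF subset_rfl)
      have c5 : E.card - F.card =
        ((A w).card - (F ∩ A w).card) + ((E \ A w).card - (F \ A w).card) := by omega
      simp only [Finset.forall_mem_insert]
      simp only [e1, e2]
      rw [c5, ← c1, pow_add, pow_add]
      by_cases q1 : A w ⊆ F <;> by_cases q2 : ∀ u ∈ W, ¬ A u ⊆ F
      · rw [if_neg (by tauto), if_neg (by tauto)]; simp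
      · rw [if_neg (by tauto), if_neg (by tauto)]; simp
      · rw [if_pos ⟨q1, q2⟩, if_pos q1, if_pos q2]; ring
      · rw [if_neg (by tauto), if_neg q2]; simp

/-- for a finite `d`-regular simple graph `G` with `d ≥ 1` and a real
`p ∈ [0,1]`, `t_e(G, p) ≤ (1 - p ^ d) ^ i(G)`. -/
theorem efTolerance_le_indepNum {V : Type*} [Fintype V] (G : SimpleGraph V)
    [DecidableRel G.Adj] (d : ℕ) (hd : 1 ≤ d) (hreg : G.IsRegularOfDegree d)
    (p : ℝ) (hp0 : 0 ≤ p) (hp1 : p ≤ 1) :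
    efTolerance G p ≤ (1 - p ^ d) ^ indepNum G := by
  classical
  obtain ⟨W, hW, hcard⟩ : indepNum G ∈
      {n | ∃ W : Finset V, (∀ u ∈ W, ∀ v ∈ W, ¬ G.Adj u v) ∧ W.card = n} := by
    apply Nat.sSup_mem
    · exact ⟨0, ∅, by simp, by simp⟩
    · refine ⟨Fintype.card V, ?_⟩
      rintro n ⟨W, _, rfl⟩
      exact Finset.card_le_univ W
  have key := ef_aux p (fun v => G.incidenceFinset v) W G.edgeFinset
    (fun w _ => G.incidenceFinset_subset w) (by
      intro u hu v hv huv
      rw [Finset.disjoint_left]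
      intro e he he'
      rw [SimpleGraph.mem_incidenceFinset] at he he'
      exact hW u hu v hv (G.adj_of_mem_incidenceSet huv he he'))
  have hprod : ∏ w ∈ W, (1 - p ^ (G.incidenceFinset w).card) = (1 - p ^ d) ^ indepNum G := by
    rw [← hcard, ← Finset.prod_const]
    refine Finset.prod_congr rfl fun w _ => ?_
    rw [G.card_incidenceFinset_eq_degree, hreg w]
  have hE : efTolerance G p = ∑ F ∈ G.edgeFinset.powerset,
      if (G.deleteEdges (↑F : Set (Sym2 V))).Connected then
        p ^ F.card * (1 - p) ^ (G.edgeFinset.card - F.card) else 0 := by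
    unfold efTolerance
    congr!
  rw [← hprod, ← key, hE]
  refine Finset.sum_le_sum fun F hF => ?_
  have hnn : 0 ≤ p ^ F.card * (1 - p) ^ (G.edgeFinset.card - F.card) :=
    mul_nonneg (pow_nonneg hp0 _) (pow_nonneg (by linarith) _)
  by_cases hc : (G.deleteEdges (↑F : Set (Sym2 V))).Connected
  · have hall : ∀ w ∈ W, ¬ G.incidenceFinset w ⊆ F := by
      intro w _ hsub
      obtain ⟨x, hx⟩ : ∃ x, G.Adj w x := by
        rw [← G.degree_pos_iff_exists_adj, hreg w]; exact hd
      haveI : Nontrivial V := ⟨w, x, hx.ne⟩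
      obtain ⟨y, hy⟩ := hc.preconnected.exists_adj_of_nontrivial w
      rw [SimpleGraph.deleteEdges_adj] at hy
      apply hy.2
      have : s(w, y) ∈ G.incidenceFinset w := by
        rw [SimpleGraph.mem_incidenceFinset]
        exact ⟨hy.1, by simp⟩
      exact_mod_cast hsub this
    rw [if_pos hc, if_pos hall]
  · rw [if_neg hc]
    split_ifs <;> simp [hnn]
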